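/- Let k be any field, let S = k[x, y, t₁, t₂, t₃], and let I = (t₂², t₃², t₂t₃, xy, xt₁, xt₃, yt₁, yt₂, t₁t₂, t₁t₃, xt₂ − t₁², yt₃ − t₁²). Then the Hilbert function h(m) = dim_k (S/I)_m satisfies h(0) = 1, h(1) = 5, h(2) = 3, and h(m) = 2 for all m ≥ 3; in particular it is independent of the characteristic of k. -/

import Mathlib

open MvPolynomial

/-- The Hilbert function of `S/I`: the `k`-dimension of the degree-`m`
homogeneous component of `S/I`. -/
noncomputable def hilbFn (k : Type*) [Field k] (n : ℕ)
    (I : Ideal (MvPolynomial (Fin n) k)) (m : ℕ) : ℕ :=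
  Module.finrank k
    ((MvPolynomial.homogeneousSubmodule (Fin n) k m).map
      (Ideal.Quotient.mkₐ k I).toLinearMap)

/-- A linear functional killing all multiples of the generators kills the ideal they span. -/
theorem linearMap_eq_zero_of_mem_span {k A : Type*} [Field k] [CommRing A] [Algebra k A]
    {G : Set A} (L : A →ₗ[k] k) (hL : ∀ g ∈ G, ∀ p, L (p * g) = 0) {f : A}
    (hf : f ∈ Ideal.span G) : L f = 0 := by
  suffices h : ∀ q, L (q * f) = 0 by simpa using h 1
  refine Submodule.span_induction (p := fun f _ => ∀ q, L (q * f) = 0) hL ?_ ?_ ?_ hf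
  · simp
  · intro a b _ _ ha hb q
    simp [mul_add, ha q, hb q]
  · intro c a _ ha q
    simpa [mul_assoc] using ha (q * c)

/-- The Hilbert function in degree `m` is `d` as soon as there are `d` forms spanning the degree
`m` part of the quotient, together with dual functionals vanishing on the ideal. -/
theorem hilbFn_eq_of_dual {k : Type*} [Field k] {n : ℕ} {G : Set (MvPolynomial (Fin n) k)}
    {m d : ℕ} (b : Fin d → MvPolynomial (Fin n) k) (L : Fin d → MvPolynomial (Fin n) k →ₗ[k] k)
    (hb : ∀ i, (b i).IsHomogeneous m)
    (hL : ∀ i, ∀ g ∈ G, ∀ p, L i (p * g) = 0)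
    (hdual : ∀ i j, L i (b j) = if i = j then 1 else 0)
    (hspan : (homogeneousSubmodule (Fin n) k m).map
        (Ideal.Quotient.mkₐ k (Ideal.span G)).toLinearMap ≤
      Submodule.span k (Set.range fun i => Ideal.Quotient.mkₐ k (Ideal.span G) (b i))) :
    hilbFn k n (Ideal.span G) m = d := by
  have hspan' := hspan.antisymm <| Submodule.span_le.2 <| by
    rintro _ ⟨i, rfl⟩
    exact Submodule.mem_map_of_mem (hb i)
  rw [hilbFn, hspan', finrank_span_eq_card, Fintype.card_fin]
  rw [Fintype.linearIndependent_iff]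
  intro c hc i
  have hmem : ∑ j, c j • b j ∈ Ideal.span G := by
    rw [← Ideal.Quotient.eq_zero_iff_mem, ← hc, ← Ideal.Quotient.mkₐ_eq_mk k, map_sum]
    simp only [map_smul]
  simpa [hdual] using linearMap_eq_zero_of_mem_span (L i) (hL i) hmem

theorem map_homogeneousSubmodule_zero {k A : Type*} [Field k] [CommRing A] [Algebra k A] {n : ℕ}
    (φ : MvPolynomial (Fin n) k →ₐ[k] A) :
    (homogeneousSubmodule (Fin n) k 0).map φ.toLinearMap = Submodule.span k {1} := by
  rw [homogeneousSubmodule_zero, Submodule.one_eq_span, Submodule.map_span]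
  simp

/-- A subspace contains the image of the forms of degree `m + 1` as soon as it contains the
products of variables with a set spanning the image of the forms of degree `m`. -/
theorem map_homogeneousSubmodule_succ_le {k A : Type*} [Field k] [CommRing A] [Algebra k A] {n : ℕ}
    (φ : MvPolynomial (Fin n) k →ₐ[k] A) {m : ℕ} {s : Set A} {N : Submodule k A}
    (hs : (homogeneousSubmodule (Fin n) k m).map φ.toLinearMap ≤ Submodule.span k s)
    (hN : ∀ i, ∀ a ∈ s, φ (X i) * a ∈ N) :
    (homogeneousSubmodule (Fin n) k (m + 1)).map φ.toLinearMap ≤ N := by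
  rw [add_comm, ← homogeneousSubmodule_one_pow, pow_add, pow_one, homogeneousSubmodule_one_pow,
    Submodule.map_mul, homogeneousSubmodule_one_eq_span_X, Submodule.map_span]
  refine (mul_le_mul_right hs _).trans ?_
  rw [Submodule.span_mul_span, Submodule.span_le]
  rintro _ ⟨_, ⟨_, ⟨i, rfl⟩, rfl⟩, a, ha, rfl⟩
  exact hN i a ha

/-- The generators of the ideal of the theorem. -/
def idealGens (k : Type*) [Field k] : Set (MvPolynomial (Fin 5) k) :=
  {X 3 ^ 2, X 4 ^ 2, X 3 * X 4, X 0 * X 1, X 0 * X 2, X 0 * X 4, X 1 * X 2, X 1 * X 3,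
    X 2 * X 3, X 2 * X 4, X 0 * X 3 - X 2 ^ 2, X 1 * X 4 - X 2 ^ 2}

theorem forall_mem_idealGens {k : Type*} [Field k] {P : MvPolynomial (Fin 5) k → Prop} :
    (∀ g ∈ idealGens k, P g) ↔ P (X 3 ^ 2) ∧ P (X 4 ^ 2) ∧ P (X 3 * X 4) ∧ P (X 0 * X 1) ∧
      P (X 0 * X 2) ∧ P (X 0 * X 4) ∧ P (X 1 * X 2) ∧ P (X 1 * X 3) ∧ P (X 2 * X 3) ∧
      P (X 2 * X 4) ∧ P (X 0 * X 3 - X 2 ^ 2) ∧ P (X 1 * X 4 - X 2 ^ 2) := by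
  simp [idealGens]

/-- The quotient by the ideal spanned by `idealGens`. -/
noncomputable abbrev gensQuot (k : Type*) [Field k] :
    MvPolynomial (Fin 5) k →ₐ[k] MvPolynomial (Fin 5) k ⧸ Ideal.span (idealGens k) :=
  Ideal.Quotient.mkₐ k (Ideal.span (idealGens k))

theorem gensQuot_relations (k : Type*) [Field k] :
    ∀ g ∈ idealGens k, gensQuot k g = 0 := fun g hg => by
  rw [Ideal.Quotient.mkₐ_eq_mk, Ideal.Quotient.eq_zero_iff_mem]
  exact Ideal.subset_span hg

theorem map_degree_one_le (k : Type*) [Field k] :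
    (homogeneousSubmodule (Fin 5) k 1).map (gensQuot k).toLinearMap ≤
      Submodule.span k (Set.range fun i => gensQuot k (X i)) := by
  refine map_homogeneousSubmodule_succ_le _ (map_homogeneousSubmodule_zero _).le ?_
  rintro i _ rfl
  rw [mul_one]
  exact Submodule.subset_span ⟨i, rfl⟩

theorem map_degree_two_le (k : Type*) [Field k] :
    (homogeneousSubmodule (Fin 5) k 2).map (gensQuot k).toLinearMap ≤
      Submodule.span k (Set.range fun i => gensQuot k (![X 0 ^ 2, X 1 ^ 2, X 2 ^ 2] i)) := by
  refine map_homogeneousSubmodule_succ_le _ (map_degree_one_le k) ?_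
  have h := gensQuot_relations k
  rw [forall_mem_idealGens] at h
  simp only [map_mul, map_pow, map_sub, sub_eq_zero] at h
  obtain ⟨h1, h2, h3, h4, h5, h6, h7, h8, h9, h10, h11, h12⟩ := h
  have m0 : gensQuot k (X 0) ^ 2 ∈ Submodule.span k
      (Set.range fun i => gensQuot k (![X 0 ^ 2, X 1 ^ 2, X 2 ^ 2] i)) :=
    Submodule.subset_span ⟨0, by simp⟩
  have m1 : gensQuot k (X 1) ^ 2 ∈ Submodule.span k
      (Set.range fun i => gensQuot k (![X 0 ^ 2, X 1 ^ 2, X 2 ^ 2] i)) :=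
    Submodule.subset_span ⟨1, by simp⟩
  have m2 : gensQuot k (X 2) ^ 2 ∈ Submodule.span k
      (Set.range fun i => gensQuot k (![X 0 ^ 2, X 1 ^ 2, X 2 ^ 2] i)) :=
    Submodule.subset_span ⟨2, by simp⟩
  rintro i _ ⟨j, rfl⟩
  dsimp only
  generalize gensQuot k = φ at *
  generalize Submodule.span k (Set.range fun i => φ (![X 0 ^ 2, X 1 ^ 2, X 2 ^ 2] i)) = N at *
  wlog hij : i ≤ j generalizing i j
  · rw [mul_comm]
    exact this j i (le_of_not_ge hij)
  fin_cases i <;> fin_cases j <;> first | (exfalso; revert hij; decide) | skip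
  all_goals simp only [Fin.mk_zero, Fin.mk_one, Fin.reduceFinMk, ← sq, *,
    Submodule.zero_mem]

theorem map_degree_add_three_le (k : Type*) [Field k] (m : ℕ) :
    (homogeneousSubmodule (Fin 5) k (m + 3)).map (gensQuot k).toLinearMap ≤
      Submodule.span k (Set.range fun i => gensQuot k (![X 0 ^ (m + 3), X 1 ^ (m + 3)] i)) := by
  have h := gensQuot_relations k
  rw [forall_mem_idealGens] at h
  simp only [map_mul, map_pow, map_sub, sub_eq_zero] at h
  obtain ⟨h1, h2, h3, h4, h5, h6, h7, h8, h9, h10, h11, h12⟩ := h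
  have m0 (m : ℕ) : gensQuot k (X 0) ^ (m + 3) ∈ Submodule.span k
      (Set.range fun i => gensQuot k (![X 0 ^ (m + 3), X 1 ^ (m + 3)] i)) :=
    Submodule.subset_span ⟨0, by simp⟩
  have m1 (m : ℕ) : gensQuot k (X 1) ^ (m + 3) ∈ Submodule.span k
      (Set.range fun i => gensQuot k (![X 0 ^ (m + 3), X 1 ^ (m + 3)] i)) :=
    Submodule.subset_span ⟨1, by simp⟩
  have hx (m : ℕ) (i : Fin 5) : gensQuot k (X i) * gensQuot k (X 0) ^ (m + 2) ∈ Submodule.span k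
      (Set.range fun i => gensQuot k (![X 0 ^ (m + 3), X 1 ^ (m + 3)] i)) := by
    have key (hi : gensQuot k (X i) * gensQuot k (X 0) ^ 2 = 0) :
        gensQuot k (X i) * gensQuot k (X 0) ^ (m + 2) = 0 := by
      rw [add_comm, pow_add, ← mul_assoc, hi, zero_mul]
    by_cases hi : i = 0
    · subst hi
      rw [← pow_succ']
      exact m0 m
    · rw [key]
      · exact Submodule.zero_mem _
      generalize gensQuot k = φ at *
      fin_cases i
      · simp at hi
      all_goals simp only [Fin.mk_one, Fin.reduceFinMk]; grind
  have hy (m : ℕ) (i : Fin 5) : gensQuot k (X i) * gensQuot k (X 1) ^ (m + 2) ∈ Submodule.span k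
      (Set.range fun i => gensQuot k (![X 0 ^ (m + 3), X 1 ^ (m + 3)] i)) := by
    have key (hi : gensQuot k (X i) * gensQuot k (X 1) ^ 2 = 0) :
        gensQuot k (X i) * gensQuot k (X 1) ^ (m + 2) = 0 := by
      rw [add_comm, pow_add, ← mul_assoc, hi, zero_mul]
    by_cases hi : i = 1
    · subst hi
      rw [← pow_succ']
      exact m1 m
    · rw [key]
      · exact Submodule.zero_mem _
      generalize gensQuot k = φ at *
      fin_cases i
      rotate_left
      · simp at hi
      all_goals simp only [Fin.mk_zero, Fin.reduceFinMk]; grind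
  have hs (i : Fin 5) : gensQuot k (X i) * gensQuot k (X 2) ^ 2 = 0 := by
    generalize gensQuot k = φ at *
    fin_cases i
    all_goals simp only [Fin.mk_zero, Fin.mk_one, Fin.reduceFinMk]; grind
  induction m with
  | zero =>
    refine map_homogeneousSubmodule_succ_le _ (map_degree_two_le k) ?_
    rintro i _ ⟨j, rfl⟩
    fin_cases j
    · simpa using hx 0 i
    · simpa using hy 0 i
    · change gensQuot k (X i) * gensQuot k (X 2 ^ 2) ∈ _
      rw [map_pow, hs i]
      exact Submodule.zero_mem _
  | succ m ih =>
    refine map_homogeneousSubmodule_succ_le _ ih ?_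
    rintro i _ ⟨j, rfl⟩
    fin_cases j
    · simpa using hx (m + 1) i
    · simpa using hy (m + 1) i

/-- The coefficients of linear monomials and of powers of `X 0` and `X 1` vanish on multiples of
the generators. -/
theorem lcoeff_single_mul_eq_zero {k : Type*} [Field k] (i : Fin 5) (m : ℕ)
    (h : m ≤ 1 ∨ i = 0 ∨ i = 1) :
    ∀ g ∈ idealGens k, ∀ p, lcoeff k (Finsupp.single i m) (p * g) = 0 := by
  rw [forall_mem_idealGens]
  refine ⟨?_, ?_, ?_, ?_, ?_, ?_, ?_, ?_, ?_, ?_, ?_, ?_⟩ <;> intro p <;>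
    simp only [sq, mul_sub, ← mul_assoc, map_sub, lcoeff_apply, coeff_mul_X',
      Finsupp.mem_support_iff, Finsupp.single_apply, Finsupp.tsub_apply] <;>
    rcases h with h | rfl | rfl <;> grind

theorem lcoeff_single_X_pow {k : Type*} [Field k] {n m : ℕ} (hm : m ≠ 0) (i j : Fin n) :
    lcoeff k (Finsupp.single i m) (X j ^ m) = if i = j then 1 else 0 := by
  simp only [lcoeff_apply, coeff_X_pow, Finsupp.single_left_inj hm, eq_comm]

/-- The sum of the coefficients of `X 0 * X 3`, `X 2 ^ 2` and `X 1 * X 4`. -/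
noncomputable def socleFunctional (k : Type*) [Field k] : MvPolynomial (Fin 5) k →ₗ[k] k :=
  lcoeff k (Finsupp.single 0 1 + Finsupp.single 3 1) +
    lcoeff k (Finsupp.single 2 1 + Finsupp.single 2 1) +
    lcoeff k (Finsupp.single 1 1 + Finsupp.single 4 1)

theorem socleFunctional_mul_eq_zero {k : Type*} [Field k] :
    ∀ g ∈ idealGens k, ∀ p, socleFunctional k (p * g) = 0 := by
  rw [forall_mem_idealGens]
  refine ⟨?_, ?_, ?_, ?_, ?_, ?_, ?_, ?_, ?_, ?_, ?_, ?_⟩ <;> intro p <;>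
    simp [socleFunctional, sq, mul_sub, ← mul_assoc, coeff_mul_X']

theorem socleFunctional_X_sq {k : Type*} [Field k] (i : Fin 5) :
    socleFunctional k (X i ^ 2) = if i = 2 then 1 else 0 := by
  fin_cases i <;> simp [socleFunctional, sq, coeff_mul_X', coeff_X, Finsupp.single_left_inj]

theorem stmt19 (k : Type*) [Field k] :
    letI x : MvPolynomial (Fin 5) k := X 0
    letI y : MvPolynomial (Fin 5) k := X 1
    letI t₁ : MvPolynomial (Fin 5) k := X 2
    letI t₂ : MvPolynomial (Fin 5) k := X 3
    letI t₃ : MvPolynomial (Fin 5) k := X 4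
    letI I : Ideal (MvPolynomial (Fin 5) k) :=
      Ideal.span {t₂ ^ 2, t₃ ^ 2, t₂ * t₃, x * y, x * t₁, x * t₃,
        y * t₁, y * t₂, t₁ * t₂, t₁ * t₃,
        x * t₂ - t₁ ^ 2, y * t₃ - t₁ ^ 2}
    hilbFn k 5 I 0 = 1 ∧ hilbFn k 5 I 1 = 5 ∧ hilbFn k 5 I 2 = 3 ∧
      ∀ m, 3 ≤ m → hilbFn k 5 I m = 2 := by
  change hilbFn k 5 (Ideal.span (idealGens k)) 0 = 1 ∧
    hilbFn k 5 (Ideal.span (idealGens k)) 1 = 5 ∧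
    hilbFn k 5 (Ideal.span (idealGens k)) 2 = 3 ∧
    ∀ m, 3 ≤ m → hilbFn k 5 (Ideal.span (idealGens k)) m = 2
  refine ⟨?_, ?_, ?_, ?_⟩
  · refine hilbFn_eq_of_dual (d := 1) (fun _ => 1) (fun _ => lcoeff k (Finsupp.single 0 0))
      (fun _ => isHomogeneous_one _ _)
      (fun _ => lcoeff_single_mul_eq_zero 0 0 (by simp)) ?_ ?_
    · intro i j
      simp [Subsingleton.elim i j]
    · rw [map_homogeneousSubmodule_zero]
      simp
  · refine hilbFn_eq_of_dual X (fun i => lcoeff k (Finsupp.single i 1))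
      (fun i => isHomogeneous_X _ _)
      (fun i => lcoeff_single_mul_eq_zero i 1 (by simp)) ?_ (map_degree_one_le k)
    intro i j
    simpa using lcoeff_single_X_pow (k := k) one_ne_zero i j
  · refine hilbFn_eq_of_dual ![X 0 ^ 2, X 1 ^ 2, X 2 ^ 2]
      ![lcoeff k (Finsupp.single 0 2), lcoeff k (Finsupp.single 1 2), socleFunctional k]
      ?_ ?_ ?_ (map_degree_two_le k)
    · intro i
      fin_cases i <;> exact isHomogeneous_X_pow _ _
    · intro i
      fin_cases i
      · exact lcoeff_single_mul_eq_zero 0 2 (by simp)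
      · exact lcoeff_single_mul_eq_zero 1 2 (by simp)
      · exact socleFunctional_mul_eq_zero
    · intro i j
      fin_cases i <;> fin_cases j <;>
        simp [lcoeff_single_X_pow two_ne_zero, socleFunctional_X_sq, -lcoeff_apply]
  · intro m hm
    obtain ⟨m, rfl⟩ := Nat.exists_eq_add_of_le' hm
    refine hilbFn_eq_of_dual ![X 0 ^ (m + 3), X 1 ^ (m + 3)]
      ![lcoeff k (Finsupp.single 0 (m + 3)), lcoeff k (Finsupp.single 1 (m + 3))]
      ?_ ?_ ?_ (map_degree_add_three_le k m)
    · intro i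
      fin_cases i <;> exact isHomogeneous_X_pow _ _
    · intro i
      fin_cases i
      · exact lcoeff_single_mul_eq_zero 0 _ (by simp)
      · exact lcoeff_single_mul_eq_zero 1 _ (by simp)
    · intro i j
      fin_cases i <;> fin_cases j <;>
        simp [lcoeff_single_X_pow (Nat.succ_ne_zero (m + 2)), -lcoeff_apply, -Finsupp.single_add]
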